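/- arXiv:2012.15154 — 3 statements merged into one kernel-verified Lean document; each statement's English description precedes it below -/
import Mathlib

section
/- Let T be a K×K row-stochastic matrix (K ≥ 2) with first row (1,0,…,0), written in block form T = [[1, 0],[r, Q]], with Q irreducible and r having at least one strictly positive entry. Define x[n] = T^n x[0] for an initial opinion vector x[0] ∈ ℝ^K, and let y[n] = (x_2[n],…,x_K[n]) denote the opinions of the ordinary agents. Then y[n] converges, as n → ∞, to (I−Q)^{-1} r · x_1[0]; in particular all ordinary agents reach consensus at the stubborn agent's initial opinion times the vector (I−Q)^{-1} r. -/
open Matrix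

open Filter Topology

section Substochastic

variable {ι : Type*} [Fintype ι]

lemma mulVec_mono_of_nonneg {A : Matrix ι ι ℝ} (hA : ∀ i j, 0 ≤ A i j) {v w : ι → ℝ}
    (h : v ≤ w) : A *ᵥ v ≤ A *ᵥ w :=
  fun i => Finset.sum_le_sum fun j _ => mul_le_mul_of_nonneg_left (h j) (hA i j)

variable [DecidableEq ι]

lemma pow_apply_nonneg_of_nonneg {A : Matrix ι ι ℝ} (hA : ∀ i j, 0 ≤ A i j) (n : ℕ) (i j : ι) :
    0 ≤ (A ^ n) i j := by
  induction n generalizing i j with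
  | zero =>
    rw [pow_zero, Matrix.one_apply]
    split_ifs <;> norm_num
  | succ n ih =>
    rw [pow_succ, Matrix.mul_apply]
    exact Finset.sum_nonneg fun k _ => mul_nonneg (ih i k) (hA k j)

lemma antitone_pow_mulVec_one {A : Matrix ι ι ℝ} (hA : ∀ i j, 0 ≤ A i j)
    (h : A *ᵥ 1 ≤ 1) : Antitone fun n : ℕ => A ^ n *ᵥ (1 : ι → ℝ) := by
  refine antitone_nat_of_succ_le fun n => ?_
  rw [pow_succ, ← Matrix.mulVec_mulVec]
  exact mulVec_mono_of_nonneg (pow_apply_nonneg_of_nonneg hA n) h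

/-- A nonnegative substochastic matrix all of whose states lead to a row with positive deficit
has no nonzero nonnegative fixed vector. -/
lemma eq_zero_of_mulVec_eq_self {A : Matrix ι ι ℝ} {r s : ι → ℝ} (hA : ∀ i j, 0 ≤ A i j)
    (hr : 0 ≤ r) (hAr : A *ᵥ 1 = 1 - r) (hleak : ∀ i, ∃ k n, 0 < (A ^ n) i k ∧ 0 < r k)
    (hs : 0 ≤ s) (hfix : A *ᵥ s = s) : s = 0 := by
  rcases isEmpty_or_nonempty ι with _ | _
  · exact Subsingleton.elim _ _
  obtain ⟨i, hi⟩ := Finite.exists_max s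
  obtain ⟨k, n, hn, hk⟩ := hleak i
  have hpow : ∀ n : ℕ, A ^ n *ᵥ s = s := fun n => by
    induction n with
    | zero => simp
    | succ n ih => rw [pow_succ, ← Matrix.mulVec_mulVec, hfix, ih]
  have hsub : A *ᵥ 1 ≤ 1 := by rw [hAr]; exact sub_le_self _ hr
  have hone : (A ^ n *ᵥ (1 : ι → ℝ)) i ≤ 1 := by
    simpa using antitone_pow_mulVec_one hA hsub (Nat.zero_le n) i
  have hdef : 0 < (A ^ n *ᵥ r) i :=
    Finset.sum_pos' (fun j _ => mul_nonneg (pow_apply_nonneg_of_nonneg hA n i j) (hr j))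
      ⟨k, Finset.mem_univ k, mul_pos hn hk⟩
  have hle : (A ^ (n + 1) *ᵥ s) i ≤ (A ^ (n + 1) *ᵥ (s i • (1 : ι → ℝ))) i :=
    mulVec_mono_of_nonneg (pow_apply_nonneg_of_nonneg hA _) (fun j => by simpa using hi j) i
  rw [hpow, Matrix.mulVec_smul, pow_succ, ← Matrix.mulVec_mulVec, hAr, Matrix.mulVec_sub] at hle
  simp only [Pi.smul_apply, Pi.sub_apply, smul_eq_mul] at hle
  have hsi : s i ≤ 0 := by nlinarith [hs i]
  exact funext fun j => le_antisymm ((hi j).trans hsi) (hs j)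

lemma tendsto_pow_zero_of_substochastic {A : Matrix ι ι ℝ} {r : ι → ℝ} (hA : ∀ i j, 0 ≤ A i j)
    (hr : 0 ≤ r) (hAr : A *ᵥ 1 = 1 - r) (hleak : ∀ i, ∃ k n, 0 < (A ^ n) i k ∧ 0 < r k) :
    Tendsto (fun n : ℕ => A ^ n) atTop (𝓝 0) := by
  have hsub : A *ᵥ 1 ≤ 1 := by rw [hAr]; exact sub_le_self _ hr
  have hnonneg : ∀ (n : ℕ) i, 0 ≤ (A ^ n *ᵥ (1 : ι → ℝ)) i := fun n i =>
    Finset.sum_nonneg fun j _ => mul_nonneg (pow_apply_nonneg_of_nonneg hA n i j) zero_le_one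
  obtain ⟨s, hs⟩ : ∃ s, Tendsto (fun n : ℕ => A ^ n *ᵥ (1 : ι → ℝ)) atTop (𝓝 s) :=
    ⟨_, tendsto_pi_nhds.2 fun i => tendsto_atTop_ciInf
      (fun _ _ h => antitone_pow_mulVec_one hA hsub h i)
      ⟨0, by rintro _ ⟨n, rfl⟩; exact hnonneg n i⟩⟩
  have hs_nonneg : 0 ≤ s := ge_of_tendsto' hs hnonneg
  have hfix : A *ᵥ s = s := by
    refine tendsto_nhds_unique ?_ (hs.comp (tendsto_add_atTop_nat 1))
    have hcont : Continuous fun v : ι → ℝ => A *ᵥ v := by fun_prop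
    refine ((hcont.tendsto s).comp hs).congr fun n => ?_
    simp only [Function.comp_apply, Matrix.mulVec_mulVec, pow_succ']
  rw [eq_zero_of_mulVec_eq_self hA hr hAr hleak hs_nonneg hfix] at hs
  refine tendsto_pi_nhds.2 fun i => tendsto_pi_nhds.2 fun j =>
    squeeze_zero (fun n => pow_apply_nonneg_of_nonneg hA n i j) (fun n => ?_)
      (tendsto_pi_nhds.1 hs i)
  simpa [Matrix.mulVec, dotProduct] using Finset.single_le_sum
    (fun k _ => pow_apply_nonneg_of_nonneg hA n i k) (Finset.mem_univ j)

lemma tendsto_pow_mulVec_zero {A : Matrix ι ι ℝ}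
    (h : Tendsto (fun n : ℕ => A ^ n) atTop (𝓝 0)) (v : ι → ℝ) :
    Tendsto (fun n : ℕ => A ^ n *ᵥ v) atTop (𝓝 0) := by
  have hcont : Continuous fun B : Matrix ι ι ℝ => B *ᵥ v := by fun_prop
  simpa [Function.comp_def] using (hcont.tendsto 0).comp h

lemma isUnit_one_sub_of_tendsto_pow_zero {A : Matrix ι ι ℝ}
    (h : Tendsto (fun n : ℕ => A ^ n) atTop (𝓝 0)) : IsUnit (1 - A) := by
  refine Matrix.mulVec_injective_iff_isUnit.1 fun v w hvw => sub_eq_zero.1 ?_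
  have hfix : A *ᵥ (v - w) = v - w := by
    have h0 : (1 - A) *ᵥ (v - w) = 0 := by rw [Matrix.mulVec_sub, sub_eq_zero]; exact hvw
    rw [Matrix.sub_mulVec, Matrix.one_mulVec, sub_eq_zero] at h0
    exact h0.symm
  have hpow : ∀ n : ℕ, A ^ n *ᵥ (v - w) = v - w := fun n => by
    induction n with
    | zero => simp
    | succ n ih => rw [pow_succ, ← Matrix.mulVec_mulVec, hfix, ih]
  refine tendsto_nhds_unique ?_ (tendsto_pow_mulVec_zero h (v - w))
  simp only [hpow, tendsto_const_nhds]

end Substochastic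

/-- **DeGroot model with a stubborn agent: consensus at the stubborn agent's opinion.**
`T` is a `(m+1) × (m+1)` row-stochastic matrix (so `K = m+1 ≥ 2` agents) whose first row is
`(1,0,…,0)`, written in block form `T = [[1, 0],[r, Q]]` where `r i = T (i+1) 0` and
`Q i j = T (i+1) (j+1)`, with `Q` irreducible and at least one entry of `r` positive.
Opinions evolve by `x[n] = T^n x[0]`.  Then the ordinary agents' opinions
`y[n] = (x_2[n],…,x_K[n])` converge to `(I-Q)⁻¹ r · x_1[0]`. -/
theorem degroot_stubborn_consensus {m : ℕ} (hm : 1 ≤ m)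
    (T : Matrix (Fin (m + 1)) (Fin (m + 1)) ℝ)
    (hT_nonneg : ∀ i j, 0 ≤ T i j)
    (hT_rowsum : ∀ i, ∑ j, T i j = 1)
    (hT_first : ∀ j, T 0 j = if j = 0 then (1 : ℝ) else 0)
    (Q : Matrix (Fin m) (Fin m) ℝ) (hQ : ∀ i j, Q i j = T i.succ j.succ)
    (r : Fin m → ℝ) (hr : ∀ i, r i = T i.succ 0)
    (hQ_irred : ∀ i j, ∃ n, 1 ≤ n ∧ 0 < (Q ^ n) i j)
    (hr_pos : ∃ i, 0 < r i)
    (x : Fin (m + 1) → ℝ) :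
    Filter.Tendsto (fun n => fun i : Fin m => (T ^ n *ᵥ x) i.succ) Filter.atTop
      (nhds (fun i : Fin m => ((1 - Q)⁻¹ *ᵥ r) i * x 0)) := by
  have hQ_nonneg : ∀ i j, 0 ≤ Q i j := fun i j => by rw [hQ]; exact hT_nonneg _ _
  have hr_nonneg : 0 ≤ r := fun i => by rw [hr]; exact hT_nonneg _ _
  have hQr : Q *ᵥ 1 = 1 - r := by
    funext i
    have hsum := hT_rowsum i.succ
    rw [Fin.sum_univ_succ, ← hr] at hsum
    simp only [Matrix.mulVec, dotProduct, Pi.one_apply, mul_one, Pi.sub_apply, hQ]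
    linarith
  obtain ⟨k, hk⟩ := hr_pos
  have hpow : Tendsto (fun n : ℕ => Q ^ n) atTop (𝓝 0) :=
    tendsto_pow_zero_of_substochastic hQ_nonneg hr_nonneg hQr fun i =>
      let ⟨n, _, hn⟩ := hQ_irred i k
      ⟨k, n, hn, hk⟩
  have hinv : (1 - Q)⁻¹ *ᵥ r = 1 := by
    have hr_eq : r = (1 - Q) *ᵥ 1 := by
      rw [Matrix.sub_mulVec, Matrix.one_mulVec, hQr, sub_sub_cancel]
    rw [hr_eq, Matrix.mulVec_mulVec, Matrix.nonsing_inv_mul _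
      ((Matrix.isUnit_iff_isUnit_det _).1 (isUnit_one_sub_of_tendsto_pow_zero hpow)),
      Matrix.one_mulVec]
  have hzero : ∀ n : ℕ, (T ^ n *ᵥ x) 0 = x 0 := fun n => by
    induction n with
    | zero => simp
    | succ n ih =>
      rw [pow_succ', ← Matrix.mulVec_mulVec, ← ih]
      simp [Matrix.mulVec, dotProduct, hT_first]
  have hord : ∀ n : ℕ, (fun i : Fin m => (T ^ n *ᵥ x) i.succ) =
      x 0 • 1 + Q ^ n *ᵥ ((fun i : Fin m => x i.succ) - x 0 • 1) := fun n => by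
    induction n with
    | zero => simp
    | succ n ih =>
      have hstep : (fun i : Fin m => (T ^ (n + 1) *ᵥ x) i.succ) =
          x 0 • r + Q *ᵥ (fun i : Fin m => (T ^ n *ᵥ x) i.succ) := by
        funext i
        rw [pow_succ', ← Matrix.mulVec_mulVec]
        simp only [Matrix.mulVec.eq_1 T, Matrix.mulVec.eq_1 Q, dotProduct, Fin.sum_univ_succ,
          hzero, Pi.add_apply, Pi.smul_apply, smul_eq_mul, hQ, hr, mul_comm (x 0)]
      rw [hstep, ih, Matrix.mulVec_add, Matrix.mulVec_smul, hQr, Matrix.mulVec_mulVec,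
        ← pow_succ', ← add_assoc, ← smul_add, add_sub_cancel]
  have hlim : (fun i : Fin m => ((1 - Q)⁻¹ *ᵥ r) i * x 0) = x 0 • 1 + 0 := by
    funext i
    simp [hinv]
  rw [funext hord, hlim]
  exact tendsto_const_nhds.add (tendsto_pow_mulVec_zero hpow _)
end

section
/- In the RA model with a stubborn agent, the difference sequence ΔS[n] = S[n] − S[n−1] of S[n] = ψᵀY[n] converges to 0 in m-th mean for every m ≥ 1: for all integers m ≥ 1, E[|ΔS[n]|^m] → 0 as n → ∞. -/
open MeasureTheory Filter

/-- **The Random Actions (RA) model with a stubborn agent.**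
`K = m + 1 ≥ 2` agents, agent `0` being the stubborn one; `α ∈ (0,1)`; `T` a row-stochastic
trust matrix with first row `(1,0,…,0)`, written in block form `T = [[1,0],[r,Q]]` where
`r i = T (i+1) 0` and `Q i j = T (i+1) (j+1)`; `Q` is irreducible and `r` has a positive entry.
On a probability space with filtration `ℱ`, the opinion process `X n` takes values in `[0,1]^K`,
is adapted, and satisfies `X_0[n] = 0` a.s.; the action process `A n` takes values in `{0,1}^K`,
is `ℱ (n+1)`-measurable, satisfies `A_0[n] = 0` a.s., and conditionally on `ℱ n` its coordinates
are independent Bernoulli with parameters `X n` (encoded by `hA_cond`: for every finite set `s`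
of agents, `E[∏_{k ∈ s} A_k[n] | ℱ n] = ∏_{k ∈ s} X_k[n]` a.s.); the update rule is
`X[n+1] = (1-α) X[n] + α T A[n]`. -/
structure RAStubbornModel (m : ℕ) (Ω : Type*) [mΩ : MeasurableSpace Ω] (μ : Measure Ω) where
  α : ℝ
  T : Matrix (Fin (m + 1)) (Fin (m + 1)) ℝ
  ℱ : Filtration ℕ mΩ
  X : ℕ → Ω → Fin (m + 1) → ℝ
  A : ℕ → Ω → Fin (m + 1) → ℝ
  hα : α ∈ Set.Ioo (0 : ℝ) 1
  hT_nonneg : ∀ i j, 0 ≤ T i j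
  hT_rowsum : ∀ i, ∑ j, T i j = 1
  hT_first : ∀ j, T 0 j = if j = 0 then (1 : ℝ) else 0
  hQ_irred : ∀ i j : Fin m, ∃ n, 1 ≤ n ∧
    0 < ((Matrix.of fun (a b : Fin m) => T a.succ b.succ) ^ n) i j
  hr_pos : ∃ i : Fin m, 0 < T i.succ 0
  hX_mem : ∀ n ω k, X n ω k ∈ Set.Icc (0 : ℝ) 1
  hX_adapted : ∀ n, Measurable[ℱ n] (X n)
  hX_stub : ∀ n, ∀ᵐ ω ∂μ, X n ω 0 = 0
  hA_val : ∀ n ω k, A n ω k = 0 ∨ A n ω k = 1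
  hA_meas : ∀ n, Measurable[ℱ (n + 1)] (A n)
  hA_stub : ∀ n, ∀ᵐ ω ∂μ, A n ω 0 = 0
  hA_cond : ∀ n (s : Finset (Fin (m + 1))),
    μ[fun ω => ∏ k ∈ s, A n ω k | ℱ n] =ᵐ[μ] fun ω => ∏ k ∈ s, X n ω k
  h_update : ∀ n ω k, X (n + 1) ω k = (1 - α) * X n ω k + α * ∑ j, T k j * A n ω j

namespace RAStubbornModel

variable {m : ℕ} {Ω : Type*} [mΩ : MeasurableSpace Ω] {μ : Measure Ω}

lemma integral_X_zero (M : RAStubbornModel m Ω μ) (n : ℕ) : ∫ ω, M.X n ω 0 ∂μ = 0 :=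
  integral_eq_zero_of_ae (M.hX_stub n)

variable [IsProbabilityMeasure μ]

lemma integrable_X (M : RAStubbornModel m Ω μ) (n : ℕ) (k : Fin (m + 1)) :
    Integrable (fun ω => M.X n ω k) μ :=
  Integrable.of_mem_Icc 0 1
    ((measurable_pi_apply k).comp ((M.hX_adapted n).mono (M.ℱ.le n) le_rfl)).aemeasurable
    (ae_of_all _ fun ω => M.hX_mem n ω k)

lemma integrable_A (M : RAStubbornModel m Ω μ) (n : ℕ) (k : Fin (m + 1)) :
    Integrable (fun ω => M.A n ω k) μ :=
  Integrable.of_mem_Icc 0 1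
    ((measurable_pi_apply k).comp ((M.hA_meas n).mono (M.ℱ.le _) le_rfl)).aemeasurable
    (ae_of_all _ fun ω => by rcases M.hA_val n ω k with h | h <;> simp [h])

lemma integral_A (M : RAStubbornModel m Ω μ) (n : ℕ) (k : Fin (m + 1)) :
    ∫ ω, M.A n ω k ∂μ = ∫ ω, M.X n ω k ∂μ := by
  have h := M.hA_cond n {k}
  simp only [Finset.prod_singleton] at h
  rw [← integral_condExp (M.ℱ.le n), integral_congr_ae h]

lemma integral_X_succ (M : RAStubbornModel m Ω μ) (n : ℕ) (k : Fin (m + 1)) :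
    ∫ ω, M.X (n + 1) ω k ∂μ
      = (1 - M.α) * ∫ ω, M.X n ω k ∂μ + M.α * ∑ j, M.T k j * ∫ ω, M.X n ω j ∂μ := by
  have hA : ∀ j ∈ Finset.univ, Integrable (fun ω => M.T k j * M.A n ω j) μ :=
    fun j _ => (M.integrable_A n j).const_mul _
  simp_rw [M.h_update]
  rw [integral_add ((M.integrable_X n k).const_mul _) ((integrable_finsetSum _ hA).const_mul _),
    integral_const_mul, integral_const_mul, integral_finsetSum _ hA]
  simp_rw [integral_const_mul, M.integral_A]

/-- The weighted mean of the non-stubborn agents' expected opinions decays geometrically when the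
weights form a left eigenvector of the non-stubborn block. -/
lemma sum_mul_integral_X (M : RAStubbornModel m Ω μ) {lam : ℝ} {ψ : Fin m → ℝ}
    (hψ : ∀ j, ∑ i, ψ i * M.T i.succ j.succ = lam * ψ j) (n : ℕ) :
    ∑ i, ψ i * ∫ ω, M.X n ω (Fin.succ i) ∂μ
      = (1 - M.α + M.α * lam) ^ n * ∑ i, ψ i * ∫ ω, M.X 0 ω (Fin.succ i) ∂μ := by
  induction n with
  | zero => simp
  | succ n ih =>
    have hsum : ∑ i, ψ i * ∑ j : Fin m, M.T i.succ j.succ * ∫ ω, M.X n ω j.succ ∂μ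
        = lam * ∑ i, ψ i * ∫ ω, M.X n ω (Fin.succ i) ∂μ := by
      simp_rw [Finset.mul_sum, ← mul_assoc]
      rw [Finset.sum_comm]
      simp_rw [← Finset.sum_mul, hψ]
    rw [pow_succ', mul_assoc, ← ih]
    simp_rw [M.integral_X_succ, Fin.sum_univ_succ (n := m), M.integral_X_zero, mul_zero, zero_add,
      mul_add, Finset.sum_add_distrib, mul_left_comm (ψ _), ← Finset.mul_sum]
    rw [hsum]
    ring

end RAStubbornModel

/-- **Convergence in `m`-th mean of the increments of `S[n] = ψᵀ Y[n]`.**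
In the RA model with a stubborn agent, with `lam ∈ (0,1)` the spectral radius of `Q` and `ψ` a
positive left eigenvector of `Q` for `lam` normalized to sum `1`, the difference sequence
`ΔS[n] = S[n] - S[n-1]` of `S[n] = ψᵀ Y[n]` converges to `0` in `p`-th mean for every `p ≥ 1`:
`E[|ΔS[n]|^p] → 0` as `n → ∞`. -/
theorem RA_stubborn_S_mth_mean_convergence {m : ℕ} (hm : 1 ≤ m) {Ω : Type*} [MeasurableSpace Ω]
    {μ : Measure Ω} [IsProbabilityMeasure μ] (M : RAStubbornModel m Ω μ)
    (lam : ℝ) (hlam : lam ∈ Set.Ioo (0 : ℝ) 1)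
    (hlam_spec : spectralRadius ℂ
        ((Matrix.of fun (a b : Fin m) => M.T a.succ b.succ).map (Complex.ofReal ·))
      = ENNReal.ofReal lam)
    (ψ : Fin m → ℝ) (hψ_pos : ∀ i, 0 < ψ i) (hψ_sum : ∑ i, ψ i = 1)
    (hψ_eig : ∀ j, ∑ i, ψ i * M.T i.succ j.succ = lam * ψ j)
    (S : ℕ → Ω → ℝ) (hS : ∀ n ω, S n ω = ∑ i : Fin m, ψ i * M.X n ω i.succ) :
    ∀ p : ℕ, 1 ≤ p →
      Tendsto (fun n => ∫ ω, |S (n + 1) ω - S n ω| ^ p ∂μ) atTop (nhds 0) := by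
  intro p hp
  have hα := M.hα
  have hS_int : ∀ n, Integrable (S n) μ := fun n => by
    rw [funext (hS n)]
    exact integrable_finsetSum _ fun i _ => (M.integrable_X n i.succ).const_mul _
  have hS_nonneg : ∀ n ω, 0 ≤ S n ω := fun n ω => by
    rw [hS]
    exact Finset.sum_nonneg fun i _ => mul_nonneg (hψ_pos i).le (M.hX_mem n ω i.succ).1
  have hS_le : ∀ n ω, S n ω ≤ 1 := fun n ω => by
    rw [hS, ← hψ_sum]
    exact Finset.sum_le_sum fun i _ =>
      mul_le_of_le_one_right (hψ_pos i).le (M.hX_mem n ω i.succ).2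
  have hS_lim : Tendsto (fun n => ∫ ω, S n ω ∂μ) atTop (nhds 0) := by
    have h : ∀ n, ∫ ω, S n ω ∂μ = (1 - M.α + M.α * lam) ^ n
        * ∑ i, ψ i * ∫ ω, M.X 0 ω (Fin.succ i) ∂μ := fun n => by
      simp_rw [hS]
      rw [integral_finsetSum _ fun i _ => (M.integrable_X n i.succ).const_mul _,
        ← M.sum_mul_integral_X hψ_eig n]
      simp_rw [integral_const_mul]
    simp_rw [h]
    have h0 : 0 ≤ 1 - M.α + M.α * lam := by linarith [hα.2, mul_pos hα.1 hlam.1]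
    have h1 : 1 - M.α + M.α * lam < 1 := by linarith [mul_lt_of_lt_one_right hα.1 hlam.2]
    simpa using (tendsto_pow_atTop_nhds_zero_of_lt_one h0 h1).mul_const _
  refine squeeze_zero (fun n => integral_nonneg fun ω => by positivity) (fun n => ?_)
    (g := fun n => ∫ ω, S (n + 1) ω ∂μ + ∫ ω, S n ω ∂μ)
    (by simpa using (hS_lim.comp (tendsto_add_atTop_nat 1)).add hS_lim)
  rw [← integral_add (hS_int _) (hS_int _)]
  refine integral_mono_of_nonneg (ae_of_all _ fun ω => by positivity)
    ((hS_int _).add (hS_int _)) (ae_of_all _ fun ω => ?_)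
  have h0 := hS_nonneg n ω
  have h0' := hS_nonneg (n + 1) ω
  have h1 := hS_le n ω
  have h1' := hS_le (n + 1) ω
  exact (pow_le_of_le_one (abs_nonneg _) (abs_le.2 ⟨by linarith, by linarith⟩)
    (by omega)).trans (abs_le.2 ⟨by linarith, by linarith⟩)
end

section
/- In the RA model, the process Q[n] = πᵀX[n] is a martingale with respect to the filtration (F_n): for all n, E[Q[n+1] | F_n] = Q[n] almost surely. -/
open MeasureTheory Filter

/-- **The Random Actions (RA) opinion-dynamics model.**
`K` agents; `α ∈ (0,1)`; `T` a `K × K` row-stochastic trust matrix.  On a probability space with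
filtration `ℱ`, the opinion process `X n : Ω → Fin K → ℝ` takes values in `[0,1]^K` and is
adapted; the action process `A n` takes values in `{0,1}^K`, is `ℱ (n+1)`-measurable, and
conditionally on `ℱ n` its coordinates are independent Bernoulli with parameters `X n`
(encoded by `hA_cond`: for every finite set `s` of agents,
`E[∏_{k ∈ s} A_k[n] | ℱ n] = ∏_{k ∈ s} X_k[n]` a.s.); the update rule is
`X[n+1] = (1-α) X[n] + α T A[n]`. -/
structure RAModel (K : ℕ) (Ω : Type*) [mΩ : MeasurableSpace Ω] (μ : Measure Ω) where
  α : ℝ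
  T : Matrix (Fin K) (Fin K) ℝ
  ℱ : Filtration ℕ mΩ
  X : ℕ → Ω → Fin K → ℝ
  A : ℕ → Ω → Fin K → ℝ
  hα : α ∈ Set.Ioo (0 : ℝ) 1
  hT_nonneg : ∀ i j, 0 ≤ T i j
  hT_rowsum : ∀ i, ∑ j, T i j = 1
  hX_mem : ∀ n ω k, X n ω k ∈ Set.Icc (0 : ℝ) 1
  hX_adapted : ∀ n, Measurable[ℱ n] (X n)
  hA_val : ∀ n ω k, A n ω k = 0 ∨ A n ω k = 1
  hA_meas : ∀ n, Measurable[ℱ (n + 1)] (A n)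
  hA_cond : ∀ n (s : Finset (Fin K)),
    μ[fun ω => ∏ k ∈ s, A n ω k | ℱ n] =ᵐ[μ] fun ω => ∏ k ∈ s, X n ω k
  h_update : ∀ n ω k, X (n + 1) ω k = (1 - α) * X n ω k + α * ∑ j, T k j * A n ω j

namespace RAModel

variable {K : ℕ} {Ω : Type*} [mΩ : MeasurableSpace Ω] {μ : Measure Ω}

lemma measurable_X (M : RAModel K Ω μ) (n : ℕ) (k : Fin K) :
    Measurable[M.ℱ n] fun ω => M.X n ω k :=
  (measurable_pi_apply k).comp (M.hX_adapted n)

lemma measurable_A (M : RAModel K Ω μ) (n : ℕ) (k : Fin K) :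
    Measurable fun ω => M.A n ω k :=
  ((measurable_pi_apply k).comp (M.hA_meas n)).mono (M.ℱ.le (n + 1)) le_rfl

lemma integrable_X [IsFiniteMeasure μ] (M : RAModel K Ω μ) (n : ℕ) (k : Fin K) :
    Integrable (fun ω => M.X n ω k) μ := by
  refine .of_bound ((M.measurable_X n k).mono (M.ℱ.le n) le_rfl).aestronglyMeasurable 1
    (ae_of_all _ fun ω => ?_)
  rw [Real.norm_of_nonneg (M.hX_mem n ω k).1]
  exact (M.hX_mem n ω k).2

lemma integrable_A [IsFiniteMeasure μ] (M : RAModel K Ω μ) (n : ℕ) (k : Fin K) :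
    Integrable (fun ω => M.A n ω k) μ := by
  refine .of_bound (M.measurable_A n k).aestronglyMeasurable 1 (ae_of_all _ fun ω => ?_)
  rcases M.hA_val n ω k with h | h <;> simp [h]

lemma condExp_A (M : RAModel K Ω μ) (n : ℕ) (k : Fin K) :
    μ[fun ω => M.A n ω k | M.ℱ n] =ᵐ[μ] fun ω => M.X n ω k := by
  simpa using M.hA_cond n {k}

/-- A left eigenvector `π` of `T` for eigenvalue `1` turns the update rule into a scalar recursion
for `πᵀ X`. -/
lemma sum_mul_X_succ (M : RAModel K Ω μ) {π : Fin K → ℝ}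
    (hπ : ∀ j, ∑ i, π i * M.T i j = π j) (n : ℕ) (ω : Ω) :
    ∑ k, π k * M.X (n + 1) ω k =
      (1 - M.α) * ∑ k, π k * M.X n ω k + M.α * ∑ k, π k * M.A n ω k := by
  have h : ∑ k, π k * M.A n ω k = ∑ k, π k * ∑ j, M.T k j * M.A n ω j := by
    simp_rw [Finset.mul_sum]
    rw [Finset.sum_comm]
    simp_rw [← mul_assoc, ← Finset.sum_mul, hπ]
  rw [h, Finset.mul_sum, Finset.mul_sum, ← Finset.sum_add_distrib]
  refine Finset.sum_congr rfl fun k _ => ?_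
  rw [M.h_update]
  ring

lemma condExp_sum_mul_A [IsFiniteMeasure μ] (M : RAModel K Ω μ) (π : Fin K → ℝ) (n : ℕ) :
    μ[fun ω => ∑ k, π k * M.A n ω k | M.ℱ n] =ᵐ[μ] fun ω => ∑ k, π k * M.X n ω k := by
  have hsum : (fun ω => ∑ k, π k * M.A n ω k) = ∑ k, π k • fun ω => M.A n ω k := by
    ext ω
    simp
  rw [hsum]
  refine (condExp_finsetSum (fun k _ => (M.integrable_A n k).smul (π k)) _).trans ?_
  have h : ∀ᵐ ω ∂μ, ∀ k, (μ[π k • fun ω => M.A n ω k | M.ℱ n]) ω = π k * M.X n ω k := by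
    refine ae_all_iff.2 fun k => ?_
    filter_upwards [condExp_smul (μ := μ) (π k) (fun ω => M.A n ω k) (M.ℱ n),
      M.condExp_A n k] with ω h1 h2
    rw [h1, Pi.smul_apply, h2, smul_eq_mul]
  filter_upwards [h] with ω hω
  simp [hω]

end RAModel

/-- **`Q[n] = πᵀ X[n]` is a martingale.**
In the RA model, with `π` a positive left eigenvector of `T` for eigenvalue `1` normalized to
sum `1`, the process `Q[n] = πᵀ X[n]` is a martingale with respect to the filtration `ℱ`:
for all `n`, `E[Q[n+1] | ℱ n] = Q[n]` almost surely. -/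
theorem RA_pi_martingale {K : ℕ} (hK : 1 ≤ K) {Ω : Type*} [MeasurableSpace Ω]
    {μ : Measure Ω} [IsProbabilityMeasure μ] (M : RAModel K Ω μ)
    (π : Fin K → ℝ) (hπ_pos : ∀ k, 0 < π k) (hπ_sum : ∑ k, π k = 1)
    (hπ_eig : ∀ j, ∑ i, π i * M.T i j = π j)
    (Qp : ℕ → Ω → ℝ) (hQp : ∀ n ω, Qp n ω = ∑ k, π k * M.X n ω k) :
    (∀ n, μ[Qp (n + 1) | M.ℱ n] =ᵐ[μ] Qp n) ∧ Martingale Qp M.ℱ μ := by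
  obtain rfl : Qp = fun n ω => ∑ k, π k * M.X n ω k := funext₂ hQp
  have hmeas (n : ℕ) : StronglyMeasurable[M.ℱ n] fun ω => ∑ k, π k * M.X n ω k :=
    (Finset.measurable_sum _ fun k _ => (M.measurable_X n k).const_mul (π k)).stronglyMeasurable
  have hint (n : ℕ) : Integrable (fun ω => ∑ k, π k * M.X n ω k) μ :=
    integrable_finsetSum _ fun k _ => (M.integrable_X n k).const_mul (π k)
  have hintA (n : ℕ) : Integrable (fun ω => ∑ k, π k * M.A n ω k) μ :=
    integrable_finsetSum _ fun k _ => (M.integrable_A n k).const_mul (π k)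
  have hcond (n : ℕ) : μ[fun ω => ∑ k, π k * M.X (n + 1) ω k | M.ℱ n] =ᵐ[μ]
      fun ω => ∑ k, π k * M.X n ω k := by
    have hrec : (fun ω => ∑ k, π k * M.X (n + 1) ω k) =
        ((1 - M.α) • fun ω => ∑ k, π k * M.X n ω k) +
          M.α • fun ω => ∑ k, π k * M.A n ω k :=
      funext fun ω => M.sum_mul_X_succ hπ_eig n ω
    rw [hrec]
    filter_upwards [condExp_add ((hint n).smul (1 - M.α)) ((hintA n).smul M.α) (M.ℱ n),
      condExp_smul (μ := μ) (1 - M.α) (fun ω => ∑ k, π k * M.X n ω k) (M.ℱ n),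
      condExp_smul (μ := μ) M.α (fun ω => ∑ k, π k * M.A n ω k) (M.ℱ n),
      M.condExp_sum_mul_A π n] with ω hadd hX hA hAX
    rw [hadd, Pi.add_apply, hX, hA, Pi.smul_apply, Pi.smul_apply, hAX,
      condExp_of_stronglyMeasurable (M.ℱ.le n) (hmeas n) (hint n), ← add_smul]
    simp
  exact ⟨hcond, martingale_nat hmeas hint fun n => (hcond n).symm⟩
end
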